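/- Let n ≥ 4 and let v, α be real vectors of length n with v_1 ≥ v_2 = v_3 ≥ v_4 ≥ ... ≥ v_n ≥ 0, α_1 = α_2 ≥ α_3 ≥ ... ≥ α_n ≥ 0. Let N = Σ_{i=1}^{n} α_i v_i and D = Σ_{i=1}^{n−1} α_i v_{i+1} + α_n v_1, and assume N ≥ D and D − α_1 v_2 > 0. Let N' and D' be the corresponding quantities for the (n−1)-dimensional instance obtained by deleting α_2 from α and v_2 from v, i.e., N' = α_1 v_1 + Σ_{i=3}^{n} α_i v_i and D' = α_1 v_3 + Σ_{i=3}^{n−1} α_i v_{i+1} + α_n v_1. Then N' = N − α_1 v_2, D' = D − α_1 v_2, and N/D ≤ N'/D'. -/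

import Mathlib

open Finset

/-- Split off the first two terms of a sum over `Fin n`. -/
theorem sum_eq_first_two_add_filter {n : ℕ} (hn : 2 ≤ n) (f : Fin n → ℝ) :
    ∑ i, f i = f ⟨0, by omega⟩ + f ⟨1, by omega⟩ +
      ∑ i ∈ univ.filter (fun i : Fin n => 2 ≤ (i : ℕ)), f i := by
  have h : (univ : Finset (Fin n)) = insert ⟨0, by omega⟩ (insert ⟨1, by omega⟩
      (univ.filter (fun i : Fin n => 2 ≤ (i : ℕ)))) := by
    ext i
    simp only [mem_univ, mem_insert, mem_filter, Fin.ext_iff, true_and, true_iff]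
    omega
  rw [h, sum_insert (by simp), sum_insert (by simp), ← h, add_assoc]

/-- Split off the last term of a sum over the indices of `Fin n` that are at least `2`. -/
theorem sum_filter_two_le_eq_add_last {n : ℕ} (hn : 3 ≤ n) (f : Fin n → ℝ) :
    ∑ i ∈ univ.filter (fun i : Fin n => 2 ≤ (i : ℕ)), f i =
      ∑ i ∈ univ.filter (fun i : Fin n => 2 ≤ (i : ℕ) ∧ (i : ℕ) < n - 1), f i +
        f ⟨n - 1, by omega⟩ := by
  have h : univ.filter (fun i : Fin n => 2 ≤ (i : ℕ)) = insert ⟨n - 1, by omega⟩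
      (univ.filter (fun i : Fin n => 2 ≤ (i : ℕ) ∧ (i : ℕ) < n - 1)) := by
    ext i
    simp only [mem_univ, mem_insert, mem_filter, Fin.ext_iff, true_and]
    omega
  rw [h, sum_insert (by simp), add_comm]

/-- Subtracting the same nonnegative amount from both parts of a ratio that is at least one
does not decrease it. -/
theorem div_le_sub_div_sub {N D c : ℝ} (hc : 0 ≤ c) (hDN : D ≤ N) (hD : 0 < D - c) :
    N / D ≤ (N - c) / (D - c) := by
  rw [div_le_div_iff₀ (by linarith) hD]
  nlinarith [mul_le_mul_of_nonneg_left hDN hc]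

/-- The elimination step for a duplicate slot/bidder pair: let `n ≥ 4`, let `v` be
sorted values with `v_2 = v_3` and `v_n ≥ 0`, let `α` be sorted nonnegative CTRs with
`α_1 = α_2`.  Let `N = ∑ α_i v_i` be the optimal welfare and
`D = ∑_{i=1}^{n−1} α_i v_{i+1} + α_n v_1` the welfare allocated by the cyclic
permutation `π_n = (2, ..., n, 1)` (realized by `finRotate n`), and suppose `N ≥ D`
and `D − α_1 v_2 > 0`.  Then the corresponding quantities
`N' = α_1 v_1 + ∑_{i=3}^{n} α_i v_i` and
`D' = α_1 v_3 + ∑_{i=3}^{n−1} α_i v_{i+1} + α_n v_1` of the reduced instance obtained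
by deleting `α_2` and `v_2` satisfy `N' = N − α_1 v_2`, `D' = D − α_1 v_2` and
`N/D ≤ N'/D'`. -/
theorem duplicate_slot_elimination (n : ℕ) (hn : 4 ≤ n) (v α : Fin n → ℝ)
    (hvsorted : ∀ i j : Fin n, i ≤ j → v j ≤ v i)
    (hv23 : v ⟨1, by omega⟩ = v ⟨2, by omega⟩) (hvnonneg : ∀ i, 0 ≤ v i)
    (hα12 : α ⟨0, by omega⟩ = α ⟨1, by omega⟩)
    (hαsorted : ∀ i j : Fin n, i ≤ j → α j ≤ α i) (hαnonneg : ∀ i, 0 ≤ α i)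
    (hND : ∑ i, α i * v (finRotate n i) ≤ ∑ i, α i * v i)
    (hDpos : 0 < (∑ i, α i * v (finRotate n i)) - α ⟨0, by omega⟩ * v ⟨1, by omega⟩) :
    (α ⟨0, by omega⟩ * v ⟨0, by omega⟩ +
        ∑ i ∈ univ.filter (fun i : Fin n => 2 ≤ (i : ℕ)), α i * v i =
      (∑ i, α i * v i) - α ⟨0, by omega⟩ * v ⟨1, by omega⟩) ∧
    (α ⟨0, by omega⟩ * v ⟨2, by omega⟩ +
        (∑ i ∈ univ.filter (fun i : Fin n => 2 ≤ (i : ℕ) ∧ (i : ℕ) < n - 1),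
          α i * v (finRotate n i)) +
        α ⟨n - 1, by omega⟩ * v ⟨0, by omega⟩ =
      (∑ i, α i * v (finRotate n i)) - α ⟨0, by omega⟩ * v ⟨1, by omega⟩) ∧
    (∑ i, α i * v i) / (∑ i, α i * v (finRotate n i)) ≤
      ((∑ i, α i * v i) - α ⟨0, by omega⟩ * v ⟨1, by omega⟩) /
        ((∑ i, α i * v (finRotate n i)) - α ⟨0, by omega⟩ * v ⟨1, by omega⟩) := by
  have rotate_zero : finRotate n ⟨0, by omega⟩ = ⟨1, by omega⟩ := by
    obtain ⟨m, rfl⟩ : ∃ m, n = m + 1 := ⟨n - 1, by omega⟩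
    exact finRotate_of_lt (by omega)
  have rotate_one : finRotate n ⟨1, by omega⟩ = ⟨2, by omega⟩ := by
    obtain ⟨m, rfl⟩ : ∃ m, n = m + 1 := ⟨n - 1, by omega⟩
    exact finRotate_of_lt (by omega)
  have rotate_last : finRotate n ⟨n - 1, by omega⟩ = ⟨0, by omega⟩ := by
    obtain ⟨m, rfl⟩ : ∃ m, n = m + 1 := ⟨n - 1, by omega⟩
    exact finRotate_last'
  refine ⟨?_, ?_, div_le_sub_div_sub (mul_nonneg (hαnonneg _) (hvnonneg _)) hND hDpos⟩
  · rw [sum_eq_first_two_add_filter (by omega) (fun i => α i * v i), ← hα12]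
    ring
  · rw [sum_eq_first_two_add_filter (by omega) (fun i => α i * v (finRotate n i)),
      sum_filter_two_le_eq_add_last (by omega), rotate_zero, rotate_one, rotate_last, ← hα12]
    ring
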